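/- arXiv:1108.3685 — 2 statements merged into one kernel-verified Lean document; each statement's English description precedes it below -/
import Mathlib

section
/- Dickson's theorem: the subalgebra of GL_n(F_p)-invariants of the polynomial ring F_p[y_1,...,y_n] (where GL_n(F_p) acts by linear substitutions of the variables) is the polynomial algebra F_p[d_{n,1},...,d_{n,n}]; that is, the Dickson invariants d_{n,1},...,d_{n,n} are algebraically independent over F_p and generate the invariant subalgebra. -/
open MvPolynomial Matrix

/-- The algebra automorphism of `F_p[y_1,...,y_n]` induced by `g ∈ GL_n(F_p)`
(linear substitution of the variables: `y_i ↦ ∑_j g_{j i} y_j`). -/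
noncomputable def glAct (p n : ℕ) (g : GL (Fin n) (ZMod p)) :
    MvPolynomial (Fin n) (ZMod p) →ₐ[ZMod p] MvPolynomial (Fin n) (ZMod p) :=
  aeval fun i => ∑ j, C ((g : Matrix (Fin n) (Fin n) (ZMod p)) j i) * X j

/-- The total Steenrod operation `P_t`, the algebra homomorphism with
`P_t(y_i) = y_i + y_i^p t`. -/
noncomputable def Pt (p n : ℕ) :
    MvPolynomial (Fin n) (ZMod p) →ₐ[ZMod p] Polynomial (MvPolynomial (Fin n) (ZMod p)) :=
  aeval fun i => Polynomial.C (X i) + Polynomial.C (X i ^ p) * Polynomial.X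

/-- The Steenrod operation `P^k`: the coefficient of `t^k` in `P_t(f)`. -/
noncomputable def steenrod (p n k : ℕ) (f : MvPolynomial (Fin n) (ZMod p)) :
    MvPolynomial (Fin n) (ZMod p) :=
  (Pt p n f).coeff k

/-- The Dickson invariant `d_{n,i}`, defined from the identity
`∏_{v ∈ F_p^n} (X + v·y) = ∑_{i=0}^n (-1)^i d_{n,i} X^{p^{n-i}}`. -/
noncomputable def dickson (p n i : ℕ) [NeZero p] : MvPolynomial (Fin n) (ZMod p) :=
  (-1) ^ i *
    (∏ v : Fin n → ZMod p,
      (Polynomial.X + Polynomial.C (∑ j, C (v j) * X j))).coeff (p ^ (n - i))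

/-- The iterated Steenrod operation `P(c,j) = P^{p^{c-j+1}} ∘ ⋯ ∘ P^{p^{c-1}} ∘ P^{p^c}`
(`P^{p^c}` applied first). -/
noncomputable def Pcj (p n c : ℕ) : ℕ → MvPolynomial (Fin n) (ZMod p) → MvPolynomial (Fin n) (ZMod p)
  | 0 => id
  | j + 1 => fun f => steenrod p n (p ^ (c + 1 - (j + 1))) (Pcj p n c j f)

/-- Apply the composite `P^{p^{s_1}} ∘ P^{p^{s_2}} ∘ ⋯ ∘ P^{p^{s_r}}` (last entry applied first). -/
noncomputable def steenrodList (p n : ℕ) :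
    List ℕ → MvPolynomial (Fin n) (ZMod p) → MvPolynomial (Fin n) (ZMod p)
  | [] => id
  | s :: rest => fun f => steenrod p n (p ^ s) (steenrodList p n rest f)

/-- The `A`-submodule of `A[X]` spanned by the monomials `X ^ p ^ i`. -/
noncomputable def linearizedPolynomials (p : ℕ) (A : Type*) [CommRing A] :
    Submodule A (Polynomial A) :=
  Submodule.span A (Set.range fun i : ℕ => (Polynomial.X : Polynomial A) ^ p ^ i)

namespace linearizedPolynomials

variable {p : ℕ} {A : Type*} [CommRing A] {f : Polynomial A}

theorem X_mem : (Polynomial.X : Polynomial A) ∈ linearizedPolynomials p A :=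
  Submodule.subset_span ⟨0, by simp⟩

theorem coeff_eq_zero (hf : f ∈ linearizedPolynomials p A) {m : ℕ} (hm : ∀ i, m ≠ p ^ i) :
    f.coeff m = 0 := by
  induction hf using Submodule.span_induction with
  | mem g hg =>
    obtain ⟨i, rfl⟩ := hg
    simp [Polynomial.coeff_X_pow, hm i]
  | zero => simp
  | add g h _ _ hg hh => simp [hg, hh]
  | smul a g _ hg => simp [hg]

theorem pow_char_mem [Fact p.Prime] [CharP A p] (hf : f ∈ linearizedPolynomials p A) :
    f ^ p ∈ linearizedPolynomials p A := by
  induction hf using Submodule.span_induction with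
  | mem g hg =>
    obtain ⟨i, rfl⟩ := hg
    exact Submodule.subset_span ⟨i + 1, by simp only [pow_succ, pow_mul]⟩
  | zero => simp [(Fact.out : p.Prime).ne_zero]
  | add g h _ _ hg hh => rw [add_pow_char]; exact add_mem hg hh
  | smul a g _ hg => rw [smul_pow]; exact Submodule.smul_mem _ _ hg

theorem comp_X_add_C [Fact p.Prime] [CharP A p] (hf : f ∈ linearizedPolynomials p A) (a : A) :
    f.comp (Polynomial.X + Polynomial.C a) = f + Polynomial.C (f.eval a) := by
  induction hf using Submodule.span_induction with
  | mem g hg =>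
    obtain ⟨i, rfl⟩ := hg
    simp [add_pow_char_pow]
  | zero => simp
  | add g h _ _ hg hh => simp only [Polynomial.add_comp, hg, hh, Polynomial.eval_add, map_add]; ring
  | smul b g _ hg => simp [hg, Polynomial.smul_eq_C_mul, mul_add]

theorem eval_smul [Fact p.Prime] [Algebra (ZMod p) A] (hf : f ∈ linearizedPolynomials p A)
    (c : ZMod p) (a : A) : f.eval (c • a) = c • f.eval a := by
  induction hf using Submodule.span_induction with
  | mem g hg =>
    obtain ⟨i, rfl⟩ := hg
    simp [smul_pow, ZMod.pow_card_pow]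
  | zero => simp
  | add g h _ _ hg hh => simp [hg, hh]
  | smul b g _ hg => simp [hg]

end linearizedPolynomials

theorem ZMod.prod_X_add_C (p : ℕ) [Fact p.Prime] :
    ∏ c : ZMod p, (Polynomial.X + Polynomial.C c) = Polynomial.X ^ p - Polynomial.X := by
  have hp : 1 < p := (Fact.out : p.Prime).one_lt
  have hmonic : (Polynomial.X ^ p - Polynomial.X : Polynomial (ZMod p)).Monic :=
    Polynomial.monic_X_pow_sub (by simpa using hp)
  have hroots := FiniteField.roots_X_pow_card_sub_X (ZMod p)
  rw [ZMod.card] at hroots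
  have h := Polynomial.prod_multiset_X_sub_C_of_monic_of_roots_card_eq hmonic (by
    rw [hroots, FiniteField.X_pow_card_sub_X_natDegree_eq _ hp]; simp)
  rw [hroots] at h
  rw [← h, ← Equiv.prod_comp (Equiv.neg (ZMod p))]
  simp [sub_eq_add_neg]

theorem prod_add_smul {p : ℕ} [Fact p.Prime] {A : Type*} [CommRing A] [IsDomain A]
    [Algebra (ZMod p) A] (t a : A) :
    ∏ c : ZMod p, (t + c • a) = t ^ p - a ^ (p - 1) * t := by
  have hp : 1 < p := (Fact.out : p.Prime).one_lt
  rcases eq_or_ne a 0 with rfl | ha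
  · simp [Nat.sub_ne_zero_of_lt hp]
  apply IsFractionRing.injective A (FractionRing A)
  set φ := algebraMap A (FractionRing A)
  have hφa : φ a ≠ 0 := by simpa [φ] using ha
  have h := congrArg (Polynomial.aeval (φ t / φ a)) (ZMod.prod_X_add_C p)
  simp only [map_prod, map_add, map_sub, map_pow, Polynomial.aeval_X, Polynomial.aeval_C] at h
  have h2 (c : ZMod p) : φ (t + c • a) = φ a * (φ t / φ a + algebraMap (ZMod p) _ c) := by
    rw [Algebra.smul_def, map_add, map_mul, ← IsScalarTower.algebraMap_apply]
    field_simp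
  simp only [map_prod, h2, Finset.prod_mul_distrib, h, Finset.prod_const, Finset.card_univ,
    ZMod.card, map_sub, map_pow, map_mul]
  obtain ⟨q, rfl⟩ := Nat.exists_eq_add_of_lt hp
  simp only [Nat.add_sub_cancel, div_pow]
  field_simp
  ring

/-- The polynomial `∏ (X + v·w)`, over all `v` in `F_p^k`. -/
noncomputable def linearFormProd {p k : ℕ} [NeZero p] {A : Type*} [CommRing A] [Algebra (ZMod p) A]
    (w : Fin k → A) : Polynomial A :=
  ∏ v : Fin k → ZMod p, (Polynomial.X + Polynomial.C (∑ j, v j • w j))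

section

variable {p : ℕ} [Fact p.Prime] {A : Type*} [CommRing A] [Algebra (ZMod p) A]

theorem linearFormProd_succ [IsDomain A] {k : ℕ} (w : Fin (k + 1) → A)
    (h : linearFormProd (p := p) (Fin.tail w) ∈ linearizedPolynomials p A) :
    linearFormProd (p := p) w = linearFormProd (p := p) (Fin.tail w) ^ p -
      Polynomial.C ((linearFormProd (p := p) (Fin.tail w)).eval (w 0)) ^ (p - 1) *
        linearFormProd (p := p) (Fin.tail w) := by
  have : CharP A p := charP_of_injective_algebraMap (algebraMap (ZMod p) A).injective p
  rw [← prod_add_smul, linearFormProd, ← (Fin.consEquiv fun _ => ZMod p).prod_comp,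
    Fintype.prod_prod_type]
  refine Finset.prod_congr rfl fun c _ => ?_
  rw [Polynomial.smul_C, ← linearizedPolynomials.eval_smul h,
    ← linearizedPolynomials.comp_X_add_C h, linearFormProd, Polynomial.prod_comp]
  refine Finset.prod_congr rfl fun v _ => ?_
  simp [Fin.sum_univ_succ, Fin.tail, add_assoc]

theorem linearFormProd_mem_linearizedPolynomials [IsDomain A] {k : ℕ} (w : Fin k → A) :
    linearFormProd (p := p) w ∈ linearizedPolynomials p A := by
  induction k with
  | zero => simpa [linearFormProd] using linearizedPolynomials.X_mem
  | succ k ih =>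
    have : CharP A p := charP_of_injective_algebraMap (algebraMap (ZMod p) A).injective p
    have h := ih (Fin.tail w)
    rw [linearFormProd_succ w h, ← map_pow, ← Polynomial.smul_eq_C_mul]
    exact sub_mem (linearizedPolynomials.pow_char_mem h) (Submodule.smul_mem _ _ h)

theorem linearFormProd_monic {k : ℕ} (w : Fin k → A) : (linearFormProd (p := p) w).Monic :=
  Polynomial.monic_prod_of_monic _ _ fun _ _ => Polynomial.monic_X_add_C _

theorem linearFormProd_natDegree [Nontrivial A] {k : ℕ} (w : Fin k → A) :
    (linearFormProd (p := p) w).natDegree = p ^ k := by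
  rw [linearFormProd, Polynomial.natDegree_prod_of_monic _ _ fun _ _ => Polynomial.monic_X_add_C _]
  simp only [Polynomial.natDegree_X_add_C]
  simp

theorem map_linearFormProd {B : Type*} [CommRing B] [Algebra (ZMod p) B] (φ : A →ₐ[ZMod p] B)
    {k : ℕ} (w : Fin k → A) :
    (linearFormProd (p := p) w).map φ = linearFormProd (p := p) (φ ∘ w) := by
  simp only [linearFormProd, Polynomial.map_prod, Polynomial.map_add, Polynomial.map_X,
    Polynomial.map_C]
  simp

theorem eval_linearFormProd_eq_zero_iff [IsDomain A] {k : ℕ} (w : Fin k → A) (x : A) :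
    (linearFormProd (p := p) w).eval x = 0 ↔ ∃ v : Fin k → ZMod p, x = ∑ j, v j • w j := by
  simp only [linearFormProd, Polynomial.eval_prod, Finset.prod_eq_zero_iff, Finset.mem_univ,
    true_and, Polynomial.eval_add, Polynomial.eval_X, Polynomial.eval_C]
  rw [(Equiv.neg (Fin k → ZMod p)).exists_congr_left]
  simp [add_eq_zero_iff_eq_neg]

end

theorem linearFormProd_mulVec {p : ℕ} [Fact p.Prime] {A : Type*} [CommRing A] [Algebra (ZMod p) A]
    {k : ℕ} (w : Fin k → A) (g : GL (Fin k) (ZMod p)) :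
    linearFormProd (p := p) (fun i => ∑ j, (g : Matrix (Fin k) (Fin k) (ZMod p)) j i • w j) =
      linearFormProd (p := p) w := by
  have hbij : Function.Bijective (g : Matrix (Fin k) (Fin k) (ZMod p)).mulVec :=
    Finite.injective_iff_bijective.mp (Matrix.mulVec_injective_iff_isUnit.mpr g.isUnit)
  refine Fintype.prod_bijective _ hbij _ _ fun v => ?_
  simp only [Matrix.mulVec, dotProduct, Finset.sum_smul, Finset.smul_sum, smul_smul]
  rw [Finset.sum_comm]
  simp only [mul_comm]

theorem MvPolynomial.sum_smul_X_injective {R : Type*} [CommRing R] {n : ℕ} :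
    Function.Injective fun v : Fin n → R => ∑ j, v j • (X j : MvPolynomial (Fin n) R) :=
  LinearIndependent.fintypeLinearCombination_injective (MvPolynomial.linearIndependent_X (Fin n) R)

theorem glAct_X {p n : ℕ} (g : GL (Fin n) (ZMod p)) (i : Fin n) :
    glAct p n g (X i) = ∑ j, (g : Matrix (Fin n) (Fin n) (ZMod p)) j i • X j := by
  simp [glAct, smul_eq_C_mul]

theorem dickson_eq_coeff_linearFormProd (p n i : ℕ) [Fact p.Prime] :
    dickson p n i = (-1) ^ i *
      (linearFormProd (p := p) (X : Fin n → MvPolynomial (Fin n) (ZMod p))).coeff (p ^ (n - i)) := by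
  simp only [dickson, linearFormProd, smul_eq_C_mul]

theorem glAct_dickson {p n : ℕ} [Fact p.Prime] (g : GL (Fin n) (ZMod p)) (i : ℕ) :
    glAct p n g (dickson p n i) = dickson p n i := by
  rw [dickson_eq_coeff_linearFormProd, map_mul, map_pow, map_neg, map_one]
  congr 1
  have h := map_linearFormProd (glAct p n g) (X : Fin n → MvPolynomial (Fin n) (ZMod p))
  have hX : glAct p n g ∘ X = fun i =>
      ∑ j, (g : Matrix (Fin n) (Fin n) (ZMod p)) j i • (X j : MvPolynomial (Fin n) (ZMod p)) :=
    funext (glAct_X g)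
  rw [hX, linearFormProd_mulVec] at h
  conv_rhs => rw [← h]
  rw [Polynomial.coeff_map]
  rfl

/-- The subalgebra generated by the Dickson invariants. -/
noncomputable abbrev dicksonSubalgebra (p n : ℕ) [Fact p.Prime] :
    Subalgebra (ZMod p) (MvPolynomial (Fin n) (ZMod p)) :=
  Algebra.adjoin (ZMod p) (Set.range fun i : Fin n => dickson p n (i.val + 1))

theorem coeff_linearFormProd_mem (p n : ℕ) [Fact p.Prime] (m : ℕ) :
    (linearFormProd (p := p) (X : Fin n → MvPolynomial (Fin n) (ZMod p))).coeff m ∈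
      dicksonSubalgebra p n := by
  by_cases hm : ∃ i, m = p ^ i
  · obtain ⟨i, rfl⟩ := hm
    have hp : 1 < p := (Fact.out : p.Prime).one_lt
    rcases lt_trichotomy i n with hi | rfl | hi
    · have h := dickson_eq_coeff_linearFormProd p n (n - i)
      rw [Nat.sub_sub_self hi.le] at h
      have h1 : dickson p n (n - i) ∈ dicksonSubalgebra p n :=
        Algebra.subset_adjoin ⟨⟨n - i - 1, by omega⟩, by
          simp only
          congr 1
          omega⟩
      have h2 := mul_mem (pow_mem (neg_mem (one_mem (dicksonSubalgebra p n))) (n - i)) h1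
      rwa [h, ← mul_assoc, ← mul_pow, neg_one_mul, neg_neg, one_pow, one_mul] at h2
    · have h := (linearFormProd_monic (p := p) (X : Fin i → MvPolynomial (Fin i) (ZMod p))).coeff_natDegree
      rw [linearFormProd_natDegree] at h
      rw [h]
      exact one_mem _
    · rw [Polynomial.coeff_eq_zero_of_natDegree_lt]
      · exact zero_mem _
      · rw [linearFormProd_natDegree]
        exact Nat.pow_lt_pow_right hp hi
  · rw [linearizedPolynomials.coeff_eq_zero (linearFormProd_mem_linearizedPolynomials _)
      (not_exists.mp hm)]
    exact zero_mem _

theorem exists_monic_map_eq_linearFormProd (p n : ℕ) [Fact p.Prime] :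
    ∃ q : Polynomial (dicksonSubalgebra p n), q.Monic ∧
      q.map (algebraMap _ (MvPolynomial (Fin n) (ZMod p))) = linearFormProd (p := p) X := by
  obtain ⟨q, hq, -, hmonic⟩ := Polynomial.lifts_and_natDegree_eq_and_monic
    (f := algebraMap (dicksonSubalgebra p n) (MvPolynomial (Fin n) (ZMod p)))
    (Polynomial.lifts_iff_coeff_lifts _ |>.mpr fun m =>
      ⟨⟨_, coeff_linearFormProd_mem p n m⟩, rfl⟩) (linearFormProd_monic X)
  exact ⟨q, hmonic, hq⟩

instance isIntegral_dicksonSubalgebra (p n : ℕ) [Fact p.Prime] :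
    Algebra.IsIntegral (dicksonSubalgebra p n) (MvPolynomial (Fin n) (ZMod p)) where
  isIntegral f := by
    induction f using MvPolynomial.induction_on with
    | C a => exact isIntegral_algebraMap (R := dicksonSubalgebra p n) (x := algebraMap _ _ a)
    | add f g hf hg => exact hf.add hg
    | mul_X f i hf =>
      refine hf.mul ?_
      obtain ⟨q, hmonic, hq⟩ := exists_monic_map_eq_linearFormProd p n
      refine ⟨q, hmonic, ?_⟩
      rw [Polynomial.eval₂_eq_eval_map, hq, eval_linearFormProd_eq_zero_iff]
      exact ⟨Pi.single i 1, by simp [Pi.single_apply]⟩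

theorem algebraicIndependent_dickson (p n : ℕ) [Fact p.Prime] :
    AlgebraicIndependent (ZMod p) (fun i : Fin n => dickson p n (i.val + 1)) :=
  have : Algebra.IsAlgebraic (dicksonSubalgebra p n) (MvPolynomial (Fin n) (ZMod p)) :=
    Algebra.IsIntegral.isAlgebraic
  (Algebra.IsAlgebraic.isTranscendenceBasis_of_lift_le_trdeg_of_finite (ZMod p)
    (fun i : Fin n => dickson p n (i.val + 1)) (by rw [MvPolynomial.trdeg_of_isDomain]; simp)).1

instance isIntegrallyClosed_dicksonSubalgebra (p n : ℕ) [Fact p.Prime] :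
    IsIntegrallyClosed (dicksonSubalgebra p n) :=
  .of_equiv (algebraicIndependent_dickson p n).aevalEquiv.toRingEquiv

/-- An injective algebra endomorphism sending the variables to linear forms restricts to the action
of an element of `GL_n(F_p)` on polynomials. -/
theorem exists_glAct_of_forall_eq_sum {p n : ℕ} [Fact p.Prime] {B : Type*} [CommRing B]
    [Algebra (ZMod p) B] (ι : MvPolynomial (Fin n) (ZMod p) →ₐ[ZMod p] B)
    (hι : Function.Injective ι) (σ : B →ₐ[ZMod p] B) (hσ : Function.Injective σ)
    (h : ∀ i, ∃ v : Fin n → ZMod p, σ (ι (X i)) = ∑ j, v j • ι (X j)) :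
    ∃ g : GL (Fin n) (ZMod p), ∀ f, σ (ι f) = ι (glAct p n g f) := by
  choose v hv using h
  let M : Matrix (Fin n) (Fin n) (ZMod p) := Matrix.of fun j i => v i j
  have hM : IsUnit M := by
    rw [← Matrix.mulVec_injective_iff_isUnit]
    intro a b hab
    apply MvPolynomial.sum_smul_X_injective
    have key (c : Fin n → ZMod p) :
        σ (ι (∑ j, c j • X j)) = ι (∑ j, M.mulVec c j • X j) := by
      simp only [map_sum, map_smul, hv, M, Matrix.mulVec, dotProduct, Matrix.of_apply,
        Finset.smul_sum, Finset.sum_smul, smul_smul]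
      rw [Finset.sum_comm]
      simp only [mul_comm]
    apply hι
    apply hσ
    simp only [key, hab]
  refine ⟨hM.unit, fun f => ?_⟩
  have : (σ.comp ι) = ι.comp (glAct p n hM.unit) := by
    ext i
    simp [glAct_X, hv, M]
  exact congrArg (fun φ => φ f) this

section

variable {p n : ℕ} [Fact p.Prime] {L K : Type*} [Field L] [Field K] [Algebra L K]
  [Algebra (MvPolynomial (Fin n) (ZMod p)) K]

theorem map_linearFormProd_X_eq_prod_X_sub_C :
    (linearFormProd (p := p) (X : Fin n → MvPolynomial (Fin n) (ZMod p))).map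
      (algebraMap (MvPolynomial (Fin n) (ZMod p)) K) =
    ∏ v : Fin n → ZMod p, (Polynomial.X - Polynomial.C
      (algebraMap (MvPolynomial (Fin n) (ZMod p)) K (∑ j, v j • X j))) := by
  rw [linearFormProd, ← Equiv.prod_comp (Equiv.neg (Fin n → ZMod p)), Polynomial.map_prod]
  refine Finset.prod_congr rfl fun v _ => ?_
  simp only [Equiv.neg_apply, Pi.neg_apply, neg_smul, Finset.sum_neg_distrib, map_neg,
    ← sub_eq_add_neg, Polynomial.map_sub, Polynomial.map_X, Polynomial.map_C]

theorem aeval_X_eq_zero_of_map_eq_linearFormProd {P : Polynomial L}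
    (hP : P.map (algebraMap L K) =
      (linearFormProd (p := p) (X : Fin n → MvPolynomial (Fin n) (ZMod p))).map
        (algebraMap _ K)) (i : Fin n) :
    Polynomial.aeval (algebraMap (MvPolynomial (Fin n) (ZMod p)) K (X i)) P = 0 := by
  rw [← Polynomial.eval_map_algebraMap, hP, Polynomial.eval_map_apply,
    (eval_linearFormProd_eq_zero_iff _ _).mpr ⟨Pi.single i 1, by simp [Pi.single_apply]⟩, map_zero]

variable [IsFractionRing (MvPolynomial (Fin n) (ZMod p)) K]

theorem separable_of_map_eq_linearFormProd {P : Polynomial L}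
    (hP : P.map (algebraMap L K) =
      (linearFormProd (p := p) (X : Fin n → MvPolynomial (Fin n) (ZMod p))).map
        (algebraMap _ K)) : P.Separable := by
  rw [← Polynomial.separable_map (algebraMap L K), hP, map_linearFormProd_X_eq_prod_X_sub_C,
    Polynomial.separable_prod_X_sub_C_iff]
  exact (IsFractionRing.injective (MvPolynomial (Fin n) (ZMod p)) K).comp
    MvPolynomial.sum_smul_X_injective

variable [Algebra (ZMod p) K] [IsScalarTower (ZMod p) (MvPolynomial (Fin n) (ZMod p)) K]
  [Algebra (ZMod p) L] [IsScalarTower (ZMod p) L K]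

theorem isSplittingField_of_map_eq_linearFormProd {P : Polynomial L}
    (hP : P.map (algebraMap L K) =
      (linearFormProd (p := p) (X : Fin n → MvPolynomial (Fin n) (ZMod p))).map
        (algebraMap _ K)) : P.IsSplittingField L K := by
  have hP0 : P ≠ 0 := (separable_of_map_eq_linearFormProd hP).ne_zero
  rw [isSplittingField_iff_intermediateField]
  refine ⟨?_, ?_⟩
  · rw [hP, map_linearFormProd_X_eq_prod_X_sub_C]
    exact Polynomial.Splits.prod fun _ _ => Polynomial.Splits.X_sub_C _
  · rw [eq_top_iff]
    intro x _
    have hR (r : MvPolynomial (Fin n) (ZMod p)) :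
        algebraMap _ K r ∈ IntermediateField.adjoin L (P.rootSet K) := by
      induction r using MvPolynomial.induction_on with
      | C a =>
        rw [← MvPolynomial.algebraMap_eq, ← IsScalarTower.algebraMap_apply,
          IsScalarTower.algebraMap_apply (ZMod p) L K]
        exact algebraMap_mem _ _
      | add f g hf hg => rw [map_add]; exact add_mem hf hg
      | mul_X f i hf =>
        rw [map_mul]
        exact mul_mem hf (IntermediateField.subset_adjoin _ _ ((Polynomial.mem_rootSet_of_ne hP0).mpr
          (aeval_X_eq_zero_of_map_eq_linearFormProd hP i)))
    obtain ⟨a, b, -, rfl⟩ := IsFractionRing.div_surjective (A := MvPolynomial (Fin n) (ZMod p)) x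
    exact div_mem (hR a) (hR b)

theorem mem_range_algebraMap_of_forall_glAct_eq {P : Polynomial L}
    (hP : P.map (algebraMap L K) =
      (linearFormProd (p := p) (X : Fin n → MvPolynomial (Fin n) (ZMod p))).map
        (algebraMap _ K)) {f : MvPolynomial (Fin n) (ZMod p)}
    (hf : ∀ g : GL (Fin n) (ZMod p), glAct p n g f = f) :
    algebraMap _ K f ∈ Set.range (algebraMap L K) := by
  have := isSplittingField_of_map_eq_linearFormProd hP
  have : IsGalois L K :=
    IsGalois.of_separable_splitting_field (separable_of_map_eq_linearFormProd hP)
  have : FiniteDimensional L K := Polynomial.IsSplittingField.finiteDimensional K P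
  rw [IsGalois.mem_range_algebraMap_iff_fixed]
  intro σ
  let ι : MvPolynomial (Fin n) (ZMod p) →ₐ[ZMod p] K := IsScalarTower.toAlgHom _ _ _
  obtain ⟨g, hg⟩ := exists_glAct_of_forall_eq_sum ι
    (IsFractionRing.injective (MvPolynomial (Fin n) (ZMod p)) K)
    ((σ : K →ₐ[L] K).restrictScalars (ZMod p)) σ.injective fun i => by
      refine (eval_linearFormProd_eq_zero_iff (ι ∘ X) _).mp ?_
      have h : P.map (algebraMap L K) = linearFormProd (p := p) (ι ∘ X) :=
        hP.trans (map_linearFormProd ι X)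
      rw [← h, Polynomial.eval_map_algebraMap]
      exact (Polynomial.aeval_algHom_apply (σ : K →ₐ[L] K) _ P).trans
        ((congrArg σ (aeval_X_eq_zero_of_map_eq_linearFormProd hP i)).trans (map_zero σ))
  exact (hg f).trans (congrArg ι (hf g))

end

theorem mem_range_algebraMap_of_isIntegrallyClosed {D R L K : Type*} [CommRing D] [CommRing R]
    [Field L] [Field K] [Algebra D R] [Algebra D L] [Algebra D K] [Algebra R K] [Algebra L K]
    [IsScalarTower D L K] [IsScalarTower D R K] [IsFractionRing D L] [IsFractionRing R K]
    [IsIntegrallyClosed D] [Algebra.IsIntegral D R] {f : R}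
    (hf : algebraMap R K f ∈ Set.range (algebraMap L K)) : f ∈ Set.range (algebraMap D R) := by
  obtain ⟨y, hy⟩ := hf
  have hint : IsIntegral D y := by
    rw [← isIntegral_algebraMap_iff (algebraMap L K).injective, hy]
    exact (Algebra.IsIntegral.isIntegral (R := D) f).algebraMap
  obtain ⟨d, rfl⟩ := IsIntegrallyClosed.isIntegral_iff.mp hint
  rw [← IsScalarTower.algebraMap_apply, IsScalarTower.algebraMap_apply D R K] at hy
  exact ⟨d, IsFractionRing.injective R K hy⟩

theorem mem_range_of_forall_glAct_eq {p n : ℕ} [Fact p.Prime] {D : Type*} [CommRing D] [IsDomain D]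
    [IsIntegrallyClosed D] [Algebra (ZMod p) D] [Algebra D (MvPolynomial (Fin n) (ZMod p))]
    [FaithfulSMul D (MvPolynomial (Fin n) (ZMod p))]
    [Algebra.IsIntegral D (MvPolynomial (Fin n) (ZMod p))] {q : Polynomial D}
    (hq : q.map (algebraMap D (MvPolynomial (Fin n) (ZMod p))) = linearFormProd (p := p) X)
    {f : MvPolynomial (Fin n) (ZMod p)} (hf : ∀ g : GL (Fin n) (ZMod p), glAct p n g f = f) :
    f ∈ Set.range (algebraMap D (MvPolynomial (Fin n) (ZMod p))) := by
  let K := FractionRing (MvPolynomial (Fin n) (ZMod p))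
  let _ : Algebra (FractionRing D) K := FractionRing.liftAlgebra D K
  have : IsScalarTower D (FractionRing D) K := FractionRing.isScalarTower_liftAlgebra D K
  have : IsScalarTower (ZMod p) (FractionRing D) K :=
    .of_algebraMap_eq' (Subsingleton.elim _ _)
  refine mem_range_algebraMap_of_isIntegrallyClosed (L := FractionRing D) (K := K)
    (mem_range_algebraMap_of_forall_glAct_eq (P := q.map (algebraMap _ _)) ?_ hf)
  rw [← hq, Polynomial.map_map, Polynomial.map_map, ← IsScalarTower.algebraMap_eq,
    ← IsScalarTower.algebraMap_eq]

theorem mem_dicksonSubalgebra_of_forall_glAct_eq {p n : ℕ} [Fact p.Prime]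
    (f : MvPolynomial (Fin n) (ZMod p)) (hf : ∀ g : GL (Fin n) (ZMod p), glAct p n g f = f) :
    f ∈ dicksonSubalgebra p n := by
  obtain ⟨q, -, hq⟩ := exists_monic_map_eq_linearFormProd p n
  obtain ⟨d, rfl⟩ := mem_range_of_forall_glAct_eq hq hf
  exact d.2

/-- **Dickson's theorem.** The `GL_n(F_p)`-invariants of `F_p[y_1,...,y_n]` form the
polynomial algebra on the Dickson invariants `d_{n,1},...,d_{n,n}`: these are algebraically
independent and generate the invariant subalgebra. -/
theorem dickson_invariants (p n : ℕ) [Fact p.Prime] :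
    AlgebraicIndependent (ZMod p) (fun i : Fin n => dickson p n (i.val + 1)) ∧
    ∀ f : MvPolynomial (Fin n) (ZMod p),
      f ∈ Algebra.adjoin (ZMod p) (Set.range fun i : Fin n => dickson p n (i.val + 1)) ↔
        ∀ g : GL (Fin n) (ZMod p), glAct p n g f = f := by
  refine ⟨algebraicIndependent_dickson p n, fun f => ⟨fun hf g => ?_,
    mem_dicksonSubalgebra_of_forall_glAct_eq f⟩⟩
  have h : dicksonSubalgebra p n ≤ AlgHom.equalizer (glAct p n g) (AlgHom.id _ _) := by
    rw [Algebra.adjoin_le_iff]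
    rintro _ ⟨i, rfl⟩
    exact glAct_dickson g _
  exact h hf
end

section
/- Let c ≥ 0 and let a_1,...,a_n ∈ {0,1,...,p-1} be not all zero. For each i with a_i ≠ 0 let k(i) ≥ 0 be a natural number such that c = k(i) + n - i - 1 when i < n and c = k(n) + n - 1 when i = n. Set m(i) = a_i p^{k(i)} (and m(i) = 0 when a_i = 0), d = ∏_{i=1}^{n} d_{n,i}^{m(i)}, and j = max({n - i : 1 ≤ i < n, a_i ≠ 0} ∪ {n : if a_n ≠ 0}). Then there is a unit u ∈ F_p^× such that: if j = n, P(c,j)(d) = u · d_{n,n}^{p^{k(n)}} · d; and if j < n, P(c,j)(d) = u · d_{n,n}^{p^{k(n-j)}} · (d / d_{n,n-j}^{p^{k(n-j)}}), where the indicated quotient is the monomial obtained from d by decreasing the exponent of d_{n,n-j} by p^{k(n-j)} (which is possible since a_{n-j} ≥ 1). -/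
open MvPolynomial Matrix

section SpanPoly

variable {R : Type*} [CommRing R]

/-- A polynomial which is monic up to the scalar `a` and vanishes at as many distinct points as
its degree is `a` times the product of the corresponding linear factors. -/
theorem eq_C_mul_prod_X_add_C [IsDomain R] {ι : Type*} [Fintype ι] (g : ι → R)
    (hg : Function.Injective g) (f : Polynomial R) (a : R)
    (hdeg : f.natDegree ≤ Fintype.card ι) (hcoeff : f.coeff (Fintype.card ι) = a)
    (hroot : ∀ i, f.eval (-g i) = 0) :
    f = Polynomial.C a * ∏ i, (Polynomial.X + Polynomial.C (g i)) := by
  classical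
  have hmonic : (∏ i, (Polynomial.X + Polynomial.C (g i))).Monic :=
    Polynomial.monic_prod_of_monic _ _ fun i _ => Polynomial.monic_X_add_C _
  have hnat : (∏ i, (Polynomial.X + Polynomial.C (g i))).natDegree = Fintype.card ι := by
    rw [Polynomial.natDegree_prod_of_monic _ _ fun i _ => Polynomial.monic_X_add_C _]
    simp
  have hinj : Function.Injective fun i => -g i := neg_injective.comp hg
  refine Polynomial.eq_of_degree_sub_lt_of_eval_finset_eq
    (Finset.univ.image fun i => -g i) ?_ ?_
  · rw [Finset.card_image_of_injective _ hinj, Finset.card_univ,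
      Polynomial.degree_lt_iff_coeff_zero]
    intro m hm
    rcases hm.eq_or_lt with rfl | hlt
    · have h1 := hmonic.coeff_natDegree
      rw [hnat] at h1
      simp [h1, hcoeff]
    · rw [Polynomial.coeff_sub, Polynomial.coeff_C_mul,
        Polynomial.coeff_eq_zero_of_natDegree_lt (hdeg.trans_lt hlt),
        Polynomial.coeff_eq_zero_of_natDegree_lt (hnat.trans_lt hlt)]
      simp
  · intro x hx
    obtain ⟨i, -, rfl⟩ := Finset.mem_image.1 hx
    rw [hroot, Polynomial.eval_mul, Polynomial.eval_prod,
      Finset.prod_eq_zero (Finset.mem_univ i) (by simp), mul_zero]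

/-- The telescoping identity behind the composition of the `p`-polynomial with coefficients `E`
and `x + t x ^ p`. -/
theorem sum_mul_add_pow_telescope (p : ℕ) [Fact p.Prime] [CharP R p] (b E : ℕ → R) (t α γ x : R)
    (h0 : E 0 = α * b 0)
    (hsucc : ∀ r, E (r + 1) = α * b (r + 1) + γ * b r ^ p - t ^ p ^ r * E r) (m : ℕ) :
    ∑ r ∈ Finset.range (m + 1), E r * (x + t * x ^ p) ^ p ^ r =
      α * ∑ r ∈ Finset.range (m + 1), b r * x ^ p ^ r +
      γ * ∑ r ∈ Finset.range m, b r ^ p * x ^ p ^ (r + 1) +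
      E m * t ^ p ^ m * x ^ p ^ (m + 1) := by
  have hx : ∀ r, (x + t * x ^ p) ^ p ^ r = x ^ p ^ r + t ^ p ^ r * x ^ p ^ (r + 1) := by
    intro r
    rw [add_pow_char_pow, mul_pow, ← pow_mul, pow_succ' p r]
  simp only [hx]
  induction m with
  | zero => simp [h0]; ring
  | succ m ih =>
    rw [Finset.sum_range_succ, ih, Finset.sum_range_succ (fun r => b r * x ^ p ^ r) (m + 1),
      Finset.sum_range_succ (fun r => b r ^ p * x ^ p ^ (r + 1)) m, hsucc m]
    ring

variable (p : ℕ) [Fact p.Prime] [Algebra (ZMod p) R]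

theorem prod_add_algebraMap_mul [IsDomain R] (z w : R) :
    ∏ c : ZMod p, (z + algebraMap (ZMod p) R c * w) = z ^ p - w ^ (p - 1) * z := by
  have hp : p.Prime := Fact.out
  have : CharP R p := charP_of_injective_algebraMap (algebraMap (ZMod p) R).injective p
  by_cases hw : w = 0
  · subst hw
    simp [ZMod.card, Nat.sub_ne_zero_of_lt hp.one_lt]
  have key := eq_C_mul_prod_X_add_C (fun c : ZMod p => algebraMap (ZMod p) R c * w)
    (fun c c' h => (algebraMap (ZMod p) R).injective (mul_right_cancel₀ hw h))
    (Polynomial.X ^ p - Polynomial.C (w ^ (p - 1)) * Polynomial.X) 1 ?_ ?_ ?_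
  · have := congrArg (Polynomial.eval z) key
    simpa [Polynomial.eval_prod] using this.symm
  · rw [ZMod.card]
    refine (Polynomial.natDegree_sub_le _ _).trans (max_le (by simp) ?_)
    exact ((Polynomial.natDegree_C_mul_le _ _).trans Polynomial.natDegree_X_le).trans hp.one_lt.le
  · rw [ZMod.card, Polynomial.coeff_sub, Polynomial.coeff_C_mul, Polynomial.coeff_X_pow_self,
      Polynomial.coeff_X_of_ne_one hp.one_lt.ne']
    simp
  · intro c
    have h1 : (algebraMap (ZMod p) R c) ^ p = algebraMap (ZMod p) R c := by
      rw [← map_pow, ZMod.pow_card]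
    have h2 : w ^ (p - 1) * w = w ^ p := by
      rw [← pow_succ, Nat.sub_add_cancel hp.one_le]
    have h3 : (-(algebraMap (ZMod p) R c * w)) ^ p = -(algebraMap (ZMod p) R c * w) ^ p := by
      rw [neg_pow, neg_one_pow_char, neg_one_mul]
    simp only [Polynomial.eval_sub, Polynomial.eval_pow, Polynomial.eval_X, Polynomial.eval_mul,
      Polynomial.eval_C, h3, mul_pow, h1, ← h2]
    ring

/-- The monic polynomial whose roots are the `F_p`-linear combinations of `w`. -/
noncomputable def spanPoly {n : ℕ} (w : Fin n → R) : Polynomial R :=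
  ∏ v : Fin n → ZMod p,
    (Polynomial.X + Polynomial.C (∑ j, algebraMap (ZMod p) R (v j) * w j))

theorem sum_mul_add_pow_char_pow [IsDomain R] (b : ℕ → R) (n : ℕ) (x y : R) :
    ∑ i ∈ Finset.range n, b i * (x + y) ^ p ^ i =
      ∑ i ∈ Finset.range n, b i * x ^ p ^ i + ∑ i ∈ Finset.range n, b i * y ^ p ^ i := by
  have : CharP R p := charP_of_injective_algebraMap (algebraMap (ZMod p) R).injective p
  rw [← Finset.sum_add_distrib]
  exact Finset.sum_congr rfl fun i _ => by rw [add_pow_char_pow, mul_add]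

theorem exists_spanPoly_eq_sum [IsDomain R] {n : ℕ} (w : Fin n → R) :
    ∃ b : ℕ → R, b n = 1 ∧
      spanPoly p w = ∑ i ∈ Finset.range (n + 1), Polynomial.C (b i) * Polynomial.X ^ p ^ i := by
  have hp : p.Prime := Fact.out
  have : CharP R p := charP_of_injective_algebraMap (algebraMap (ZMod p) R).injective p
  induction n with
  | zero => exact ⟨fun _ => 1, rfl, by simp [spanPoly]⟩
  | succ n ih =>
    obtain ⟨b, hbn, hb⟩ := ih (fun i => w i.succ)
    set W : R := ∑ i ∈ Finset.range (n + 1), b i * w 0 ^ p ^ i with hW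
    have hsplit : spanPoly p w = ∏ c : ZMod p,
        (spanPoly p fun i => w i.succ).comp
          (Polynomial.X + Polynomial.C (algebraMap (ZMod p) R c * w 0)) := by
      unfold spanPoly
      rw [← Fintype.prod_equiv (Fin.consEquiv fun _ => ZMod p)
        (fun cv : ZMod p × (Fin n → ZMod p) => Polynomial.X + Polynomial.C
          (∑ j, algebraMap (ZMod p) R (Fin.cons (α := fun _ => ZMod p) cv.1 cv.2 j) * w j)) _
        (fun _ => rfl), Fintype.prod_prod_type]
      refine Finset.prod_congr rfl fun c _ => ?_
      rw [Polynomial.prod_comp]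
      refine Finset.prod_congr rfl fun v _ => ?_
      simp [Fin.sum_univ_succ, add_assoc]
    have hcomp : ∀ c : ZMod p, (spanPoly p fun i => w i.succ).comp
          (Polynomial.X + Polynomial.C (algebraMap (ZMod p) R c * w 0)) =
        (spanPoly p fun i => w i.succ) +
          algebraMap (ZMod p) (Polynomial R) c * Polynomial.C W := by
      intro c
      have hc : ∀ i, algebraMap (ZMod p) R c ^ p ^ i = algebraMap (ZMod p) R c := by
        intro i
        rw [← map_pow, ZMod.pow_card_pow]
      rw [hb, ← Polynomial.coe_compRingHom_apply, map_sum]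
      simp only [Polynomial.coe_compRingHom_apply, Polynomial.mul_comp,
        Polynomial.C_comp, Polynomial.X_pow_comp]
      rw [sum_mul_add_pow_char_pow p (fun i => Polynomial.C (b i))]
      congr 1
      rw [hW, map_sum, Finset.mul_sum]
      refine Finset.sum_congr rfl fun i _ => ?_
      rw [← map_pow, mul_pow, hc, IsScalarTower.algebraMap_apply (ZMod p) R (Polynomial R),
        Polynomial.algebraMap_eq, ← map_mul, ← map_mul, mul_left_comm]
    rw [Finset.prod_congr rfl fun c _ => hcomp c, prod_add_algebraMap_mul p] at hsplit
    refine ⟨fun i => (if i = 0 then 0 else b (i - 1) ^ p) -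
      (if i = n + 1 then 0 else W ^ (p - 1) * b i), by simp [hbn], ?_⟩
    rw [hsplit, hb, sum_pow_char]
    simp only [map_sub, sub_mul, Finset.sum_sub_distrib]
    congr 1
    · rw [Finset.sum_range_succ' _ (n + 1)]
      simp [mul_pow, ← pow_mul, pow_succ]
    · rw [Finset.sum_range_succ _ (n + 1), Finset.mul_sum]
      simp only [if_true, map_zero, zero_mul, add_zero]
      refine Finset.sum_congr rfl fun i hi => ?_
      rw [if_neg (Finset.mem_range.1 hi).ne, map_mul, map_pow]
      ring

theorem spanPoly_eq_sum_coeff [IsDomain R] {n : ℕ} (w : Fin n → R) :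
    spanPoly p w = ∑ i ∈ Finset.range (n + 1),
      Polynomial.C ((spanPoly p w).coeff (p ^ i)) * Polynomial.X ^ p ^ i ∧
    (spanPoly p w).coeff (p ^ n) = 1 := by
  have hp : p.Prime := Fact.out
  obtain ⟨b, hbn, hb⟩ := exists_spanPoly_eq_sum p w
  have hc : ∀ i ∈ Finset.range (n + 1), (spanPoly p w).coeff (p ^ i) = b i := by
    intro i hi
    rw [hb, Polynomial.finsetSum_coeff, Finset.sum_eq_single i]
    · simp
    · intro l _ hl
      rw [Polynomial.coeff_C_mul, Polynomial.coeff_X_pow,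
        if_neg fun h => hl (Nat.pow_right_injective hp.two_le h).symm, mul_zero]
    · exact fun h => absurd hi h
  refine ⟨?_, by rw [hc n (by simp), hbn]⟩
  conv_lhs => rw [hb]
  exact Finset.sum_congr rfl fun i hi => by rw [hc i hi]

end SpanPoly

/-- The truncated expansion `∑_{l ≤ r} ± t^{p^{r-1} + ⋯ + p^l} b l`. -/
noncomputable def expansionA {R : Type*} [CommRing R] (p : ℕ) (b : ℕ → R) : ℕ → Polynomial R
  | 0 => Polynomial.C (b 0)
  | r + 1 => Polynomial.C (b (r + 1)) - Polynomial.X ^ p ^ r * expansionA p b r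

/-- The truncated expansion `∑_{l < r} ± t^{p^{r-1} + ⋯ + p^{l+1}} (b l) ^ p`. -/
noncomputable def expansionB {R : Type*} [CommRing R] (p : ℕ) (b : ℕ → R) : ℕ → Polynomial R
  | 0 => 0
  | r + 1 => Polynomial.C (b r ^ p) - Polynomial.X ^ p ^ r * expansionB p b r

section Pt

variable (p n : ℕ) [Fact p.Prime]

theorem Pt_coeff_zero (f : MvPolynomial (Fin n) (ZMod p)) : (Pt p n f).coeff 0 = f := by
  have h : (Polynomial.constantCoeff).comp (Pt p n : MvPolynomial (Fin n) (ZMod p) →+* _) =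
      RingHom.id _ :=
    MvPolynomial.ringHom_ext (fun a => by simp [Pt]) (fun i => by simp [Pt])
  exact DFunLike.congr_fun h f

theorem Pt_sum_X (v : Fin n → ZMod p) :
    Pt p n (∑ j, algebraMap (ZMod p) _ (v j) * X j) =
      Polynomial.C (∑ j, algebraMap (ZMod p) _ (v j) * X j) +
        Polynomial.X * Polynomial.C (∑ j, algebraMap (ZMod p) _ (v j) * X j) ^ p := by
  have hv : ∀ j, (algebraMap (ZMod p) (MvPolynomial (Fin n) (ZMod p)) (v j)) ^ p =
      algebraMap (ZMod p) _ (v j) := fun j => by rw [← map_pow, ZMod.pow_card]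
  have hX : ∀ j, Pt p n (X j) = Polynomial.C (X j) + Polynomial.C (X j ^ p) * Polynomial.X := by
    intro j
    simp [Pt]
  rw [← map_pow, sum_pow_char, map_sum, map_sum, map_sum, Finset.mul_sum,
    ← Finset.sum_add_distrib]
  refine Finset.sum_congr rfl fun j _ => ?_
  rw [mul_pow, hv, map_mul, AlgHom.commutes, hX,
    IsScalarTower.algebraMap_apply (ZMod p) (MvPolynomial (Fin n) (ZMod p)) (Polynomial _),
    Polynomial.algebraMap_eq, map_mul, map_mul]
  ring

theorem sum_mul_X_injective :
    Function.Injective fun v : Fin n → ZMod p =>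
      ∑ j, algebraMap (ZMod p) (MvPolynomial (Fin n) (ZMod p)) (v j) * X j := by
  intro v v' h
  funext i
  have := congrArg (MvPolynomial.aeval (R := ZMod p) (Pi.single i (1 : ZMod p))) h
  simpa [Pi.single_apply] using this

/-- The coefficient of `X ^ p ^ r` in the fundamental equation. -/
noncomputable def spanCoeff (r : ℕ) : MvPolynomial (Fin n) (ZMod p) :=
  (spanPoly p (X : Fin n → MvPolynomial (Fin n) (ZMod p))).coeff (p ^ r)

theorem dickson_eq (i : ℕ) : dickson p n i = (-1) ^ i * spanCoeff p n (n - i) := rfl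

theorem spanCoeff_self : spanCoeff p n n = 1 := (spanPoly_eq_sum_coeff p _).2

theorem sum_spanCoeff_eq_zero (v : Fin n → ZMod p) :
    ∑ r ∈ Finset.range (n + 1), spanCoeff p n r *
      (∑ j, algebraMap (ZMod p) _ (v j) * X j) ^ p ^ r = 0 := by
  have h := congrArg (Polynomial.eval (∑ j, algebraMap (ZMod p) _ (v j) * X j))
    (spanPoly_eq_sum_coeff p (X : Fin n → MvPolynomial (Fin n) (ZMod p))).1
  simp only [Polynomial.eval_finsetSum, Polynomial.eval_mul, Polynomial.eval_C,
    Polynomial.eval_pow, Polynomial.eval_X] at h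
  refine h.symm.trans ?_
  rw [spanPoly, Polynomial.eval_prod, Finset.prod_eq_zero (Finset.mem_univ (-v))]
  simp [Polynomial.eval_finsetSum]

/-- The action of `P_t` on the coefficients of the fundamental equation. -/
theorem expansionA_mul_Pt_spanCoeff {r : ℕ} (hr : r ≤ n) :
    expansionA p (spanCoeff p n) n * Pt p n (spanCoeff p n r) =
      (1 - Polynomial.X ^ p ^ n * expansionB p (spanCoeff p n) n) *
        expansionA p (spanCoeff p n) r +
      expansionA p (spanCoeff p n) n * Polynomial.X ^ p ^ n *
        expansionB p (spanCoeff p n) r := by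
  have hp : p.Prime := Fact.out
  set b := spanCoeff p n with hb
  set A := expansionA p b with hA
  set B := expansionB p b with hB
  set t : Polynomial (MvPolynomial (Fin n) (ZMod p)) := Polynomial.X with ht
  set E : ℕ → Polynomial (MvPolynomial (Fin n) (ZMod p)) := fun r =>
    (1 - t ^ p ^ n * B n) * A r + A n * t ^ p ^ n * B r with hE
  set y : (Fin n → ZMod p) → MvPolynomial (Fin n) (ZMod p) := fun v =>
    ∑ j, algebraMap (ZMod p) _ (v j) * X j with hy
  set L : (Fin n → ZMod p) → Polynomial (MvPolynomial (Fin n) (ZMod p)) := fun v =>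
    Polynomial.C (y v) + t * Polynomial.C (y v) ^ p with hL
  have hEn : E n = A n := by simp only [hE]; ring
  have hLneg : ∀ v, -L v = L (-v) := by
    intro v
    rw [hL]
    simp only
    rw [← Pt_sum_X, ← Pt_sum_X, ← map_neg]
    simp [Finset.sum_neg_distrib]
  have hLinj : Function.Injective L := by
    intro v v' h
    have := congrArg (fun f => Polynomial.coeff f 0) h
    simp only [hL, ht] at this
    exact sum_mul_X_injective p n (show y v = y v' by simpa using this)
  have hvanish : ∀ v, ∑ r ∈ Finset.range (n + 1), E r * L v ^ p ^ r = 0 := by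
    intro v
    have hb0 : ∑ r ∈ Finset.range (n + 1), Polynomial.C (b r) * Polynomial.C (y v) ^ p ^ r = 0 := by
      simp only [← map_pow, ← map_mul, ← map_sum]
      rw [sum_spanCoeff_eq_zero, map_zero]
    have htel := sum_mul_add_pow_telescope p (fun r => Polynomial.C (b r)) E t
      (1 - t ^ p ^ n * B n) (A n * t ^ p ^ n) (Polynomial.C (y v))
      (by simp [hE, hA, hB, expansionA, expansionB])
      (by
        intro r
        simp only [hE, hA, hB, expansionA, expansionB, map_pow]
        ring) n
    rw [hL]
    simp only
    rw [htel, hb0, hEn, mul_zero, zero_add]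
    have hpow := congrArg (· ^ p) hb0
    simp only [sum_pow_char, mul_pow, ← pow_mul, ← pow_succ, zero_pow hp.ne_zero] at hpow
    rw [Finset.sum_range_succ, hb, spanCoeff_self, map_one, one_pow, ← hb] at hpow
    linear_combination A n * t ^ p ^ n * hpow
  set F : Polynomial (Polynomial (MvPolynomial (Fin n) (ZMod p))) :=
    ∑ r ∈ Finset.range (n + 1), Polynomial.C (E r) * Polynomial.X ^ p ^ r with hF
  have hFcoeff : ∀ r ≤ n, F.coeff (p ^ r) = E r := by
    intro r hr
    rw [hF, Polynomial.finsetSum_coeff, Finset.sum_eq_single r]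
    · simp
    · intro l _ hl
      rw [Polynomial.coeff_C_mul, Polynomial.coeff_X_pow,
        if_neg fun h => hl (Nat.pow_right_injective hp.two_le h).symm, mul_zero]
    · intro h
      exact absurd (Finset.mem_range.2 (Nat.lt_succ_of_le hr)) h
  have hcard : Fintype.card (Fin n → ZMod p) = p ^ n := by simp [ZMod.card]
  have hFeq := eq_C_mul_prod_X_add_C L hLinj F (A n)
    (by
      rw [hcard]
      refine Polynomial.natDegree_sum_le_of_forall_le _ _ fun r hr => ?_
      exact (Polynomial.natDegree_C_mul_X_pow_le _ _).trans
        (Nat.pow_le_pow_right hp.pos (Nat.lt_succ_iff.1 (Finset.mem_range.1 hr))))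
    (by rw [hcard, hFcoeff n le_rfl, hEn])
    (by
      intro v
      rw [hLneg, hF]
      simpa [Polynomial.eval_finsetSum] using hvanish (-v))
  have hmap : (spanPoly p (X : Fin n → MvPolynomial (Fin n) (ZMod p))).map
      (Pt p n : MvPolynomial (Fin n) (ZMod p) →+* _) =
      ∏ v, (Polynomial.X + Polynomial.C (L v)) := by
    rw [spanPoly, Polynomial.map_prod]
    refine Finset.prod_congr rfl fun v _ => ?_
    rw [Polynomial.map_add, Polynomial.map_X, Polynomial.map_C]
    congr 2
    exact Pt_sum_X p n v
  have := hFcoeff r hr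
  rw [hFeq, ← hmap, Polynomial.coeff_C_mul, Polynomial.coeff_map] at this
  exact this

theorem exists_expansionA_eq {R : Type*} [CommRing R] (b : ℕ → R) (r : ℕ) :
    ∃ q, expansionA p b r = Polynomial.C (b r) + Polynomial.X * q := by
  have hp : p.Prime := Fact.out
  cases r with
  | zero => exact ⟨0, by simp [expansionA]⟩
  | succ r =>
    obtain ⟨s, hs⟩ := Nat.exists_eq_add_of_le' (Nat.one_le_iff_ne_zero.2 (pow_ne_zero r hp.ne_zero))
    refine ⟨-(Polynomial.X ^ s * expansionA p b r), ?_⟩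
    rw [expansionA, hs]
    ring

theorem exists_expansionA_succ_eq {R : Type*} [CommRing R] (b : ℕ → R) (r : ℕ) :
    ∃ q, expansionA p b (r + 1) = Polynomial.C (b (r + 1)) -
      Polynomial.X ^ p ^ r * Polynomial.C (b r) + Polynomial.X ^ (p ^ r + 1) * q := by
  obtain ⟨q, hq⟩ := exists_expansionA_eq p b r
  exact ⟨-q, by rw [expansionA, hq]; ring⟩

/-- `P_t f = f + g t^M` modulo `t^(M+1)`. -/
def PtLeading (M : ℕ) (f g : MvPolynomial (Fin n) (ZMod p)) : Prop :=
  ∃ q, Pt p n f = Polynomial.C f + Polynomial.X ^ M * Polynomial.C g + Polynomial.X ^ (M + 1) * q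

/-- `P_t f = f` modulo `t^M`. -/
def PtConst (M : ℕ) (f : MvPolynomial (Fin n) (ZMod p)) : Prop :=
  ∃ q, Pt p n f = Polynomial.C f + Polynomial.X ^ M * q

theorem ptLeading_spanCoeff_succ {r : ℕ} (hr : r + 1 < n) :
    PtLeading p n (p ^ r) (spanCoeff p n (r + 1)) (-spanCoeff p n r) := by
  have hp : p.Prime := Fact.out
  obtain ⟨l, rfl⟩ : ∃ l, n = l + 1 := ⟨n - 1, by omega⟩
  have h1 : p ^ r + 1 ≤ p ^ l := Nat.pow_lt_pow_right hp.one_lt (by omega)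
  have h2 : p ^ r + 1 ≤ p ^ (l + 1) := h1.trans (Nat.pow_le_pow_right hp.pos (by omega))
  obtain ⟨s, hs⟩ := Nat.exists_eq_add_of_le h1
  obtain ⟨s', hs'⟩ := Nat.exists_eq_add_of_le h2
  have key := expansionA_mul_Pt_spanCoeff p (l + 1) hr.le
  obtain ⟨q, hq⟩ := exists_expansionA_succ_eq p (spanCoeff p (l + 1)) r
  have hA : expansionA p (spanCoeff p (l + 1)) (l + 1) =
      1 - Polynomial.X ^ p ^ l * expansionA p (spanCoeff p (l + 1)) l := by
    rw [expansionA, spanCoeff_self, map_one]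
  rw [hs', hq, hA, hs] at key
  set P := Pt p (l + 1) (spanCoeff p (l + 1) (r + 1))
  rw [pow_add, pow_add _ (p ^ r + 1) s'] at key
  refine ⟨q + Polynomial.X ^ s * expansionA p (spanCoeff p (l + 1)) l * P -
    Polynomial.X ^ s' * expansionB p (spanCoeff p (l + 1)) (l + 1) *
      expansionA p (spanCoeff p (l + 1)) (r + 1) +
    expansionA p (spanCoeff p (l + 1)) (l + 1) * Polynomial.X ^ s' *
      expansionB p (spanCoeff p (l + 1)) (r + 1), ?_⟩
  rw [map_neg, hq, hA, hs, pow_add]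
  linear_combination key

theorem ptLeading_spanCoeff_zero (l : ℕ) :
    PtLeading p (l + 1) (p ^ l) (spanCoeff p (l + 1) 0)
      (spanCoeff p (l + 1) l * spanCoeff p (l + 1) 0) := by
  have hp : p.Prime := Fact.out
  have h2 : p ^ l + 1 ≤ p ^ (l + 1) := Nat.pow_lt_pow_right hp.one_lt (by omega)
  obtain ⟨w, hw⟩ := Nat.exists_eq_add_of_le h2
  obtain ⟨s, hs⟩ : ∃ s, Pt p (l + 1) (spanCoeff p (l + 1) 0) =
      Polynomial.C (spanCoeff p (l + 1) 0) + Polynomial.X * s := by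
    refine ⟨Polynomial.divX (Pt p (l + 1) (spanCoeff p (l + 1) 0)), ?_⟩
    conv_lhs => rw [← Polynomial.X_mul_divX_add (Pt p (l + 1) (spanCoeff p (l + 1) 0)),
      Pt_coeff_zero]
    rw [add_comm (Polynomial.C _)]
  have key := expansionA_mul_Pt_spanCoeff p (l + 1) (Nat.zero_le _)
  obtain ⟨q, hq⟩ := exists_expansionA_succ_eq p (spanCoeff p (l + 1)) l
  rw [hw, hq, spanCoeff_self, map_one, expansionA, expansionB, mul_zero, add_zero,
    pow_add _ (p ^ l + 1) w] at key
  set P := Pt p (l + 1) (spanCoeff p (l + 1) 0)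
  refine ⟨Polynomial.C (spanCoeff p (l + 1) l) * s - q * P - Polynomial.X ^ w *
    expansionB p (spanCoeff p (l + 1)) (l + 1) * Polynomial.C (spanCoeff p (l + 1) 0), ?_⟩
  rw [map_mul]
  linear_combination key + Polynomial.X ^ p ^ l * Polynomial.C (spanCoeff p (l + 1) l) * hs

variable {p n}

theorem PtLeading.neg_one_pow_mul {M : ℕ} {f g : MvPolynomial (Fin n) (ZMod p)}
    (h : PtLeading p n M f g) (i : ℕ) : PtLeading p n M ((-1) ^ i * f) ((-1) ^ i * g) := by
  obtain ⟨q, hq⟩ := h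
  refine ⟨(-1) ^ i * q, ?_⟩
  simp only [map_mul, map_pow, map_neg, map_one, hq]
  ring

theorem PtLeading.mul {M : ℕ} (hM : M ≠ 0) {f g f' g' : MvPolynomial (Fin n) (ZMod p)}
    (h : PtLeading p n M f g) (h' : PtLeading p n M f' g') :
    PtLeading p n M (f * f') (g * f' + f * g') := by
  obtain ⟨q, hq⟩ := h
  obtain ⟨q', hq'⟩ := h'
  obtain ⟨s, rfl⟩ := Nat.exists_eq_add_one_of_ne_zero hM
  refine ⟨Polynomial.C f * q' + q * Pt p n f' +
    Polynomial.X ^ s * Polynomial.C g * (Polynomial.C g' + Polynomial.X * q'), ?_⟩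
  simp only [map_mul, map_add, hq, hq']
  ring

theorem PtLeading.one (M : ℕ) : PtLeading p n M 1 0 := ⟨0, by simp⟩

theorem PtLeading.pow {M : ℕ} (hM : M ≠ 0) {f g : MvPolynomial (Fin n) (ZMod p)}
    (h : PtLeading p n M f g) (a : ℕ) : PtLeading p n M (f ^ a) (a * f ^ (a - 1) * g) := by
  induction a with
  | zero => simpa using PtLeading.one M
  | succ a ih =>
    convert ih.mul hM h using 1
    · exact pow_succ f a
    cases a with
    | zero => simp
    | succ a => rw [Nat.add_sub_cancel, Nat.add_sub_cancel]; push_cast; ring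

theorem PtLeading.pow_char_pow {M : ℕ} {f g : MvPolynomial (Fin n) (ZMod p)}
    (h : PtLeading p n M f g) (k : ℕ) :
    PtLeading p n (M * p ^ k) (f ^ p ^ k) (g ^ p ^ k) := by
  have hp : p.Prime := Fact.out
  obtain ⟨q, hq⟩ := h
  obtain ⟨s, hs⟩ := Nat.exists_eq_add_of_le' (Nat.one_le_iff_ne_zero.2 (pow_ne_zero k hp.ne_zero))
  refine ⟨Polynomial.X ^ s * q ^ p ^ k, ?_⟩
  rw [map_pow, hq, add_pow_char_pow, add_pow_char_pow, mul_pow, mul_pow, ← pow_mul, ← pow_mul,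
    map_pow, map_pow, ← mul_assoc (Polynomial.X ^ (M * p ^ k + 1)), ← pow_add]
  congr 3
  rw [hs]
  ring

theorem PtLeading.prod {ι : Type*} [DecidableEq ι] {M : ℕ} (hM : M ≠ 0) (S : Finset ι)
    {f g : ι → MvPolynomial (Fin n) (ZMod p)} (h : ∀ i ∈ S, PtLeading p n M (f i) (g i)) :
    PtLeading p n M (∏ i ∈ S, f i) (∑ i ∈ S, g i * ∏ l ∈ S.erase i, f l) := by
  induction S using Finset.induction_on with
  | empty => simpa using PtLeading.one M
  | insert x S hx ih =>
    rw [Finset.prod_insert hx]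
    convert (h x (by simp)).mul hM (ih fun i hi => h i (by simp [hi])) using 1
    rw [Finset.sum_insert hx, Finset.erase_insert hx, Finset.mul_sum]
    congr 1
    refine Finset.sum_congr rfl fun i hi => ?_
    have hne : x ≠ i := fun h => hx (h ▸ hi)
    rw [Finset.erase_insert_of_ne hne, Finset.prod_insert (by simp [hx])]
    ring

theorem PtLeading.steenrod_eq {M : ℕ} (hM : M ≠ 0) {f g : MvPolynomial (Fin n) (ZMod p)}
    (h : PtLeading p n M f g) : steenrod p n M f = g := by
  obtain ⟨q, hq⟩ := h
  rw [steenrod, hq, Polynomial.coeff_add, Polynomial.coeff_add, Polynomial.coeff_C_of_ne_zero hM,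
    Polynomial.coeff_X_pow_mul', Polynomial.coeff_X_pow_mul']
  simp

theorem PtLeading.ptConst {M : ℕ} {f g : MvPolynomial (Fin n) (ZMod p)}
    (h : PtLeading p n M f g) : PtConst p n M f := by
  obtain ⟨q, hq⟩ := h
  exact ⟨Polynomial.C g + Polynomial.X * q, by rw [hq]; ring⟩

theorem PtConst.steenrod_mul {M m : ℕ} (hm : m < M) {f : MvPolynomial (Fin n) (ZMod p)}
    (h : PtConst p n M f) (g : MvPolynomial (Fin n) (ZMod p)) :
    steenrod p n m (g * f) = steenrod p n m g * f := by
  obtain ⟨q, hq⟩ := h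
  rw [steenrod, steenrod, map_mul, hq, mul_add, Polynomial.coeff_add, Polynomial.coeff_mul_C,
    mul_left_comm, Polynomial.coeff_X_pow_mul', if_neg (not_le.2 hm), add_zero]

theorem steenrod_sum {ι : Type*} (S : Finset ι) (m : ℕ)
    (f : ι → MvPolynomial (Fin n) (ZMod p)) :
    steenrod p n m (∑ i ∈ S, f i) = ∑ i ∈ S, steenrod p n m (f i) := by
  simp only [steenrod, map_sum, Polynomial.finsetSum_coeff]

theorem steenrod_smul (m : ℕ) (a : ZMod p) (f : MvPolynomial (Fin n) (ZMod p)) :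
    steenrod p n m (a • f) = a • steenrod p n m f := by
  simp only [steenrod, map_smul, Polynomial.coeff_smul]

theorem steenrod_pow_char_pow_eq_zero (f : MvPolynomial (Fin n) (ZMod p)) {m k : ℕ}
    (hm : m ≠ 0) (hmk : m < p ^ k) : steenrod p n m (f ^ p ^ k) = 0 := by
  have h : Pt p n f = Polynomial.C f + Polynomial.X * Polynomial.divX (Pt p n f) := by
    conv_lhs => rw [← Polynomial.X_mul_divX_add (Pt p n f), Pt_coeff_zero]
    rw [add_comm (Polynomial.C _)]
  rw [steenrod, map_pow, h, add_pow_char_pow, mul_pow, ← map_pow, Polynomial.coeff_add,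
    Polynomial.coeff_C_of_ne_zero hm, Polynomial.coeff_X_pow_mul', if_neg (not_le.2 hmk), add_zero]

theorem ptLeading_dickson {i : ℕ} (hi : 1 ≤ i) (hin : i < n) :
    PtLeading p n (p ^ (n - i - 1)) (dickson p n i) (dickson p n (i + 1)) := by
  have h := (ptLeading_spanCoeff_succ p n (r := n - i - 1) (by omega)).neg_one_pow_mul i
  rw [show n - i - 1 + 1 = n - i by omega] at h
  rw [dickson_eq, dickson_eq, ← Nat.sub_sub, pow_succ]
  convert h using 1
  ring

theorem ptLeading_dickson_self (hn : 1 ≤ n) :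
    PtLeading p n (p ^ (n - 1)) (dickson p n n) (-(dickson p n 1 * dickson p n n)) := by
  obtain ⟨l, rfl⟩ := Nat.exists_eq_add_of_le' hn
  have h := (ptLeading_spanCoeff_zero p l).neg_one_pow_mul (l + 1)
  rw [dickson_eq, dickson_eq, Nat.sub_self, Nat.add_sub_cancel]
  convert h using 1
  ring

theorem PtConst.one (M : ℕ) : PtConst p n M 1 := (PtLeading.one M).ptConst

theorem PtConst.mul {M : ℕ} {f g : MvPolynomial (Fin n) (ZMod p)}
    (hf : PtConst p n M f) (hg : PtConst p n M g) : PtConst p n M (f * g) := by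
  obtain ⟨q, hq⟩ := hf
  obtain ⟨q', hq'⟩ := hg
  refine ⟨Polynomial.C f * q' + q * Pt p n g, ?_⟩
  simp only [map_mul, hq, hq']
  ring

theorem PtConst.pow {M : ℕ} {f : MvPolynomial (Fin n) (ZMod p)} (hf : PtConst p n M f) (a : ℕ) :
    PtConst p n M (f ^ a) := by
  induction a with
  | zero => simpa using PtConst.one M
  | succ a ih => rw [pow_succ]; exact ih.mul hf

theorem PtConst.prod {ι : Type*} {M : ℕ} (S : Finset ι) {f : ι → MvPolynomial (Fin n) (ZMod p)}
    (h : ∀ i ∈ S, PtConst p n M (f i)) : PtConst p n M (∏ i ∈ S, f i) :=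
  Finset.prod_induction f _ (fun _ _ => PtConst.mul) (PtConst.one M) h

/-- The Dickson invariant `d_{n,s}`, extended by zero to `s > n`. -/
noncomputable def dicksonExt (p n s : ℕ) [NeZero p] : MvPolynomial (Fin n) (ZMod p) :=
  if s ≤ n then dickson p n s else 0

theorem steenrod_dicksonExt_pow {s e k : ℕ} (hs : 1 ≤ s) (h : e + s + 1 = k + n) :
    steenrod p n (p ^ e) (dicksonExt p n s ^ p ^ k) = dicksonExt p n (s + 1) ^ p ^ k := by
  have hp : p.Prime := Fact.out
  have hpk : p ^ k ≠ 0 := pow_ne_zero k hp.ne_zero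
  rcases lt_trichotomy s n with hlt | rfl | hgt
  · have hexp : p ^ (n - s - 1) * p ^ k = p ^ e := by
      rw [← pow_add]
      congr 1
      omega
    rw [dicksonExt, if_pos hlt.le, dicksonExt, if_pos (Nat.succ_le_of_lt hlt), ← hexp]
    exact ((ptLeading_dickson hs hlt).pow_char_pow k).steenrod_eq
      (hexp ▸ pow_ne_zero e hp.ne_zero)
  · rw [dicksonExt, dicksonExt, if_neg (by omega : ¬ s + 1 ≤ s), zero_pow hpk]
    exact steenrod_pow_char_pow_eq_zero _ (pow_ne_zero e hp.ne_zero)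
      (Nat.pow_lt_pow_right hp.one_lt (by omega))
  · rw [dicksonExt, dicksonExt, if_neg (by omega), if_neg (by omega), zero_pow hpk]
    simp [steenrod]

/-- A sum of multiples of `p^k i`-th powers of Dickson invariants by elements that are constant
modulo `t^(p^c)` is moved along the Dickson invariants by the operations `P(c,r)`. -/
theorem Pcj_succ_eq_sum {ι : Type*} (S : Finset ι) (c : ℕ) (s k : ι → ℕ) (u : ι → ZMod p)
    (f : MvPolynomial (Fin n) (ZMod p)) (g : ι → MvPolynomial (Fin n) (ZMod p))
    (hg : ∀ i ∈ S, u i ≠ 0 → PtConst p n (p ^ c) (g i))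
    (hk : ∀ i ∈ S, u i ≠ 0 → c + s i + 1 = k i + n)
    (hf : steenrod p n (p ^ c) f = ∑ i ∈ S, u i • (dicksonExt p n (s i + 1) ^ p ^ k i * g i))
    {r : ℕ} (hr : r ≤ c) :
    Pcj p n c (r + 1) f =
      ∑ i ∈ S, u i • (dicksonExt p n (s i + (r + 1)) ^ p ^ k i * g i) := by
  have hp : p.Prime := Fact.out
  induction r with
  | zero => simpa [Pcj] using hf
  | succ r ih =>
    rw [Pcj]
    beta_reduce
    rw [ih (by omega), steenrod_sum]
    refine Finset.sum_congr rfl fun i hi => ?_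
    by_cases hu : u i = 0
    · simp [hu, steenrod]
    have hlt : p ^ (c + 1 - (r + 1 + 1)) < p ^ c := Nat.pow_lt_pow_right hp.one_lt (by omega)
    have hki := hk i hi hu
    rw [steenrod_smul, (hg i hi hu).steenrod_mul hlt,
      steenrod_dicksonExt_pow (by omega) (by omega), add_assoc]

end Pt

/-- Lemma on the action of `P(c,j)` on a monomial `d = ∏ d_{n,i}^{m(i)}` with
`m(i) = a_i p^{k(i)}`, `0 ≤ a_i ≤ p-1` not all zero, `c = k(i) + n - i - 1` for `i < n`
(resp. `c = k(n) + n - 1`) whenever `a_i ≠ 0`, and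
`j = max({n - i : i < n, a_i ≠ 0} ∪ {n : a_n ≠ 0})`: there is a unit `u` such that
`P(c,j)(d) = u·d_{n,n}^{p^{k(n)}}·d` if `j = n`, and
`P(c,j)(d) = u·d_{n,n}^{p^{k(n-j)}}·(d / d_{n,n-j}^{p^{k(n-j)}})` if `j < n`. -/
theorem Pcj_monomial (p n : ℕ) [Fact p.Prime] (c : ℕ) (a k : ℕ → ℕ)
    (ha_lt : ∀ i, 1 ≤ i → i ≤ n → a i < p)
    (ha_ne : ∃ i, 1 ≤ i ∧ i ≤ n ∧ a i ≠ 0)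
    (hk : ∀ i, 1 ≤ i → i ≤ n → a i ≠ 0 →
      (i < n → c + i + 1 = k i + n) ∧ (i = n → c + 1 = k i + n))
    (m : ℕ → ℕ) (hm : ∀ i, m i = a i * p ^ k i)
    (j : ℕ)
    (hjmem : j ∈ ((Finset.Icc 1 n).filter fun i => a i ≠ 0).image
      fun i => if i = n then n else n - i)
    (hjmax : ∀ x ∈ ((Finset.Icc 1 n).filter fun i => a i ≠ 0).image
      fun i => if i = n then n else n - i, x ≤ j) :
    ∃ u : (ZMod p)ˣ,
      (j = n →
        Pcj p n c j (∏ i ∈ Finset.Icc 1 n, dickson p n i ^ m i) =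
          (u : ZMod p) •
            (dickson p n n ^ p ^ k n * ∏ i ∈ Finset.Icc 1 n, dickson p n i ^ m i)) ∧
      (j < n →
        Pcj p n c j (∏ i ∈ Finset.Icc 1 n, dickson p n i ^ m i) =
          (u : ZMod p) •
            (dickson p n n ^ p ^ k (n - j) *
              ∏ i ∈ Finset.Icc 1 n,
                dickson p n i ^ (if i = n - j then m i - p ^ k i else m i))) := by
  have hp : p.Prime := Fact.out
  have hM : p ^ c ≠ 0 := pow_ne_zero c hp.ne_zero
  have hn : 1 ≤ n := by
    obtain ⟨i, h1, h2, -⟩ := ha_ne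
    omega
  set s : ℕ → ℕ := fun i => if i = n then 0 else i with hs
  set d := ∏ i ∈ Finset.Icc 1 n, dickson p n i ^ m i with hd
  set u : ℕ → ZMod p := fun i => if i = n then -(a i : ZMod p) else a i with hu
  set g : ℕ → MvPolynomial (Fin n) (ZMod p) := fun i => if i = n then d else
    ∏ l ∈ Finset.Icc 1 n, dickson p n l ^ (if l = i then m l - p ^ k l else m l) with hg
  have hu_ne : ∀ i ∈ Finset.Icc 1 n, u i ≠ 0 ↔ a i ≠ 0 := by
    intro i hi
    obtain ⟨h1, h2⟩ := Finset.mem_Icc.1 hi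
    have : (a i : ZMod p) = 0 ↔ a i = 0 := by
      rw [ZMod.natCast_eq_zero_iff]
      exact ⟨fun h => Nat.eq_zero_of_dvd_of_lt h (ha_lt i h1 h2), fun h => h ▸ dvd_zero p⟩
    simp only [hu]
    split_ifs <;> simp [this]
  have hks : ∀ i ∈ Finset.Icc 1 n, a i ≠ 0 → c + s i + 1 = k i + n := by
    intro i hi hai
    obtain ⟨h1, h2⟩ := Finset.mem_Icc.1 hi
    obtain ⟨hlt, heq⟩ := hk i h1 h2 hai
    simp only [hs]
    split_ifs with h
    · simpa using heq h
    · exact hlt (lt_of_le_of_ne h2 h)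
  have hlead : ∀ i ∈ Finset.Icc 1 n, a i ≠ 0 →
      PtLeading p n (p ^ c) (dickson p n i ^ p ^ k i) (if i = n then
        -(dicksonExt p n (s i + 1) ^ p ^ k i * dickson p n i ^ p ^ k i)
        else dicksonExt p n (s i + 1) ^ p ^ k i) := by
    intro i hi hai
    obtain ⟨h1, h2⟩ := Finset.mem_Icc.1 hi
    have hki := hks i hi hai
    rcases h2.eq_or_lt with rfl | hlt
    · have h := (ptLeading_dickson_self (p := p) hn).pow_char_pow (k i)
      simp only [hs, if_true] at hki ⊢
      rw [← pow_add, show i - 1 + k i = c by omega, neg_pow, neg_one_pow_char_pow,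
        neg_one_mul, mul_pow] at h
      simpa [dicksonExt, hn] using h
    · have h := (ptLeading_dickson (p := p) h1 hlt).pow_char_pow (k i)
      simp only [hs, if_neg hlt.ne] at hki ⊢
      rw [← pow_add, show n - i - 1 + k i = c by omega] at h
      rwa [dicksonExt, if_pos (by omega)]
  have hconst : ∀ i ∈ Finset.Icc 1 n, a i ≠ 0 → ∀ e, PtConst p n (p ^ c)
      (dickson p n i ^ (e * p ^ k i)) := by
    intro i hi hai e
    rw [mul_comm, pow_mul]
    exact (hlead i hi hai).ptConst.pow e
  have hconst_m : ∀ i ∈ Finset.Icc 1 n, PtConst p n (p ^ c) (dickson p n i ^ m i) := by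
    intro i hi
    rw [hm]
    by_cases hai : a i = 0
    · simpa [hai] using PtConst.one (p := p) (n := n) (p ^ c)
    · exact hconst i hi hai _
  have hm_sub : ∀ i, m i - p ^ k i = (a i - 1) * p ^ k i := fun i => by
    rw [hm, Nat.sub_mul, one_mul]
  have hg_const : ∀ i ∈ Finset.Icc 1 n, u i ≠ 0 → PtConst p n (p ^ c) (g i) := by
    intro i hi hui
    simp only [hg]
    split_ifs with h
    · exact PtConst.prod _ hconst_m
    · refine PtConst.prod _ fun l hl => ?_
      split_ifs with hli
      · rw [hm_sub]
        exact hconst l hl (hli ▸ (hu_ne i hi).1 hui) _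
      · exact hconst_m l hl
  have hf : steenrod p n (p ^ c) d =
      ∑ i ∈ Finset.Icc 1 n, u i • (dicksonExt p n (s i + 1) ^ p ^ k i * g i) := by
    have hfac : ∀ i ∈ Finset.Icc 1 n, PtLeading p n (p ^ c) (dickson p n i ^ m i)
        (a i * (dickson p n i ^ p ^ k i) ^ (a i - 1) * (if i = n then
          -(dicksonExt p n (s i + 1) ^ p ^ k i * dickson p n i ^ p ^ k i)
          else dicksonExt p n (s i + 1) ^ p ^ k i)) := by
      intro i hi
      by_cases hai : a i = 0
      · simpa [hm, hai] using PtLeading.one (p := p) (n := n) (p ^ c)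
      · rw [hm, mul_comm (a i), pow_mul]
        exact (hlead i hi hai).pow hM (a i)
    rw [hd, (PtLeading.prod hM _ hfac).steenrod_eq hM]
    refine Finset.sum_congr rfl fun i hi => ?_
    have hcast : (a i : MvPolynomial (Fin n) (ZMod p)) = C (a i : ZMod p) := by simp
    by_cases hai : a i = 0
    · simp [hu, hai]
    obtain ⟨b, hb⟩ := Nat.exists_eq_add_one_of_ne_zero hai
    have hpow : dickson p n i ^ m i =
        (dickson p n i ^ p ^ k i) ^ (a i - 1) * dickson p n i ^ p ^ k i := by
      rw [hm, hb, Nat.add_sub_cancel, ← pow_succ, ← pow_mul, mul_comm]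
    rw [MvPolynomial.smul_eq_C_mul]
    simp only [hu, hg]
    split_ifs with h
    · rw [hd, ← Finset.mul_prod_erase _ _ hi, hpow, hcast, map_neg]
      ring
    · rw [← Finset.mul_prod_erase _ (fun l => dickson p n l ^
        (if l = i then m l - p ^ k l else m l)) hi, if_pos rfl, hm_sub, hcast,
        Finset.prod_congr rfl fun l hl =>
          congrArg (dickson p n l ^ ·) (if_neg (Finset.ne_of_mem_erase hl)),
        mul_comm (a i - 1), pow_mul]
      ring
  obtain ⟨i₀, hi₀, hj⟩ := Finset.mem_image.1 hjmem
  obtain ⟨hi₀mem, ha₀⟩ := Finset.mem_filter.1 hi₀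
  obtain ⟨hi₀1, hi₀n⟩ := Finset.mem_Icc.1 hi₀mem
  have hk₀ := hks i₀ hi₀mem ha₀
  have hjs : ∀ i, 1 ≤ i → i ≤ n → (if i = n then n else n - i) + s i = n := by
    intro i h1 h2
    simp only [hs]
    split_ifs <;> omega
  have hj₀ : j + s i₀ = n := hj ▸ hjs i₀ hi₀1 hi₀n
  have hj1 : 1 ≤ j := by
    rw [← hj]
    split_ifs <;> omega
  obtain ⟨r, rfl⟩ := Nat.exists_eq_add_of_le' hj1
  have hmain : Pcj p n c (r + 1) d =
      u i₀ • (dickson p n n ^ p ^ k i₀ * g i₀) := by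
    rw [Pcj_succ_eq_sum _ c s k u d g hg_const
      (fun i hi hui => hks i hi ((hu_ne i hi).1 hui)) hf (by omega),
      Finset.sum_eq_single_of_mem i₀ hi₀mem]
    · rw [add_comm, hj₀, dicksonExt, if_pos le_rfl]
    · intro i hi hne
      by_cases hui : u i = 0
      · rw [hui, zero_smul]
      obtain ⟨h1, h2⟩ := Finset.mem_Icc.1 hi
      have hle := hjmax _ (Finset.mem_image_of_mem _
        (Finset.mem_filter.2 ⟨hi, (hu_ne i hi).1 hui⟩))
      have hsi := hjs i h1 h2
      have hsne : s i ≠ s i₀ := by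
        simp only [hs]
        split_ifs <;> omega
      rw [dicksonExt, if_neg (by omega), zero_pow (pow_ne_zero _ hp.ne_zero), zero_mul,
        smul_zero]
  refine ⟨Units.mk0 (u i₀) ((hu_ne i₀ hi₀mem).2 ha₀), fun hjn => ?_, fun hjn => ?_⟩
  · have h : i₀ = n := by
      simp only [hs] at hj₀
      split_ifs at hj₀ <;> omega
    rw [hmain, Units.val_mk0, h]
    simp [hg]
  · have h : i₀ = n - (r + 1) := by
      simp only [hs] at hj₀
      split_ifs at hj₀ <;> omega
    have hne : i₀ ≠ n := by omega
    rw [hmain, Units.val_mk0, ← h]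
    simp only [hg, if_neg hne]
end
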